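/- arXiv:1810.08218 — 2 statements merged into one kernel-verified Lean document; each statement's English description precedes it below -/
import Mathlib

section
/- Let n and m be natural numbers with 1 ≤ m ≤ n and let c₁, c₂ ≥ 0 be real numbers. Then Σ_{i=1}^{m} ( c₁·n·√n/√i + c₂·n ) ≤ 2·(c₁ + c₂)·n·√n·√m; in particular the total number of operations of the Farthest Point Sampling algorithm using Parallel Toplesets Propagation is O(√m · n^{3/2}). -/
theorem sum_Icc_one_div_sqrt_le (m : ℕ) :
    ∑ i ∈ Finset.Icc 1 m, 1 / Real.sqrt i ≤ 2 * Real.sqrt m := by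
  induction m with
  | zero => simp
  | succ k ih =>
    rw [Finset.sum_Icc_succ_top (by omega)]
    have hpos : 0 < Real.sqrt ((k + 1 : ℕ) : ℝ) := Real.sqrt_pos.2 (by positivity)
    have hk := Real.sq_sqrt (Nat.cast_nonneg (α := ℝ) k)
    have hk' := Real.sq_sqrt (Nat.cast_nonneg (α := ℝ) (k + 1))
    have hstep : 1 / Real.sqrt ((k + 1 : ℕ) : ℝ)
        ≤ 2 * Real.sqrt ((k + 1 : ℕ) : ℝ) - 2 * Real.sqrt k := by
      rw [div_le_iff₀ hpos]
      rw [Nat.cast_succ] at hk' ⊢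
      nlinarith [sq_nonneg (Real.sqrt ((k : ℝ) + 1) - Real.sqrt k)]
    linarith

/-- For `1 ≤ m ≤ n` and `c₁, c₂ ≥ 0`,
`Σ_{i=1}^m (c₁·n·√n/√i + c₂·n) ≤ 2·(c₁ + c₂)·n·√n·√m`,
so Farthest Point Sampling via PTP costs `O(√m · n^{3/2})` operations. -/
theorem fps_total_operations_bound
    (n m : ℕ) (hm : 1 ≤ m) (hmn : m ≤ n)
    (c₁ c₂ : ℝ) (hc₁ : 0 ≤ c₁) (hc₂ : 0 ≤ c₂) :
    ∑ i ∈ Finset.Icc 1 m,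
        (c₁ * n * Real.sqrt n / Real.sqrt i + c₂ * n)
      ≤ 2 * (c₁ + c₂) * n * Real.sqrt n * Real.sqrt m := by
  have hm_le : (m : ℝ) ≤ Real.sqrt n * Real.sqrt m := by
    calc (m : ℝ) = Real.sqrt m * Real.sqrt m := (Real.mul_self_sqrt (Nat.cast_nonneg m)).symm
      _ ≤ Real.sqrt n * Real.sqrt m := by gcongr
  have hprod : 0 ≤ c₂ * n * (Real.sqrt n * Real.sqrt m) := by positivity
  calc ∑ i ∈ Finset.Icc 1 m, (c₁ * n * Real.sqrt n / Real.sqrt i + c₂ * n)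
      = c₁ * n * Real.sqrt n * ∑ i ∈ Finset.Icc 1 m, 1 / Real.sqrt i + c₂ * n * m := by
        rw [Finset.sum_add_distrib, Finset.mul_sum]
        simp [div_eq_mul_inv, mul_comm]
    _ ≤ c₁ * n * Real.sqrt n * (2 * Real.sqrt m) + c₂ * n * (Real.sqrt n * Real.sqrt m) := by
        gcongr
        exact sum_Icc_one_div_sqrt_le m
    _ ≤ 2 * (c₁ + c₂) * n * Real.sqrt n * Real.sqrt m := by linarith
end

section
/- Let G be a connected simple graph on a finite vertex set V with n = |V| vertices, let s be a vertex with eccentricity e = max_{v ∈ V} dist_G(s, v), and suppose the distance-sphere cardinalities are strictly increasing up to the eccentricity: |{ v : dist_G(s, v) = r }| > |{ v : dist_G(s, v) = r − 1 }| for every r with 1 ≤ r ≤ e. Let c be a natural number and let K : ℕ → ℕ satisfy K(1) ≤ 1 and K(r) ≤ K(r−1) + c for every r ≥ 2. Then, with ρ = e + 1 the number of toplesets, K(ρ) ≤ c·√(2n) + 1 (as real numbers); in particular the maximum number of iterations K(ρ) is O(√n). -/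
/-- If the spheres around `s` strictly increase in size up to radius `e`, then the sphere of
radius `r ≤ e` has at least `r + 1` vertices. -/
theorem succ_le_card_sphere {V : Type*} [Fintype V] (G : SimpleGraph V) (s : V) (e : ℕ)
    (hinc : ∀ r : ℕ, 1 ≤ r → r ≤ e →
      (Finset.univ.filter (fun v => G.dist s v = r - 1)).card <
      (Finset.univ.filter (fun v => G.dist s v = r)).card)
    (r : ℕ) (hr : r ≤ e) :
    r + 1 ≤ (Finset.univ.filter (fun v => G.dist s v = r)).card := by
  induction r with
  | zero => exact Finset.card_pos.mpr ⟨s, by simp⟩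
  | succ r ih =>
    have h := hinc (r + 1) (by omega) hr
    rw [Nat.add_sub_cancel] at h
    exact (Nat.succ_le_succ (ih (by omega))).trans h

/-- A graph whose spheres around `s` strictly increase in size up to radius `e` has at least
`(e + 1)(e + 2) / 2` vertices. -/
theorem mul_le_two_mul_card_of_sphere_lt {V : Type*} [Fintype V] [DecidableEq V]
    (G : SimpleGraph V) (s : V) (e : ℕ)
    (hinc : ∀ r : ℕ, 1 ≤ r → r ≤ e →
      (Finset.univ.filter (fun v => G.dist s v = r - 1)).card <
      (Finset.univ.filter (fun v => G.dist s v = r)).card) :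
    (e + 1) * (e + 2) ≤ 2 * Fintype.card V := by
  have hle : ∑ r ∈ Finset.range (e + 1), (r + 1) ≤ Fintype.card V :=
    calc ∑ r ∈ Finset.range (e + 1), (r + 1)
        ≤ ∑ r ∈ Finset.range (e + 1), (Finset.univ.filter (fun v => G.dist s v = r)).card :=
          Finset.sum_le_sum fun r hr =>
            succ_le_card_sphere G s e hinc r (Nat.lt_succ_iff.mp (Finset.mem_range.mp hr))
      _ = ((Finset.range (e + 1)).biUnion
            fun r => Finset.univ.filter (fun v => G.dist s v = r)).card := by
          rw [Finset.card_biUnion]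
          intro i _ j _ hij
          exact Finset.disjoint_filter.mpr fun v _ hi hj => hij (hi.symm.trans hj)
      _ ≤ Fintype.card V := Finset.card_le_univ _
  have hsum : 2 * ∑ r ∈ Finset.range (e + 1), (r + 1) = (e + 1) * (e + 2) := by
    clear hle hinc
    induction e with
    | zero => simp
    | succ e ih => rw [Finset.sum_range_succ, mul_add, ih]; ring
  omega

/-- A sequence starting at `K 1 ≤ 1` with increments at most `c` grows at most linearly. -/
theorem iterations_le_mul_add_one (c : ℕ) (K : ℕ → ℕ) (h1 : K 1 ≤ 1)
    (hrec : ∀ r : ℕ, 2 ≤ r → K r ≤ K (r - 1) + c) (m : ℕ) : K (m + 1) ≤ c * m + 1 := by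
  induction m with
  | zero => simpa using h1
  | succ m ih =>
    have h := hrec (m + 2) (by omega)
    rw [show m + 2 - 1 = m + 1 by omega] at h
    calc K (m + 2) ≤ c * m + 1 + c := h.trans (by omega)
      _ = c * (m + 1) + 1 := by ring

/-- For a connected finite graph with strictly increasing distance-sphere
cardinalities around `s` up to the eccentricity `e`, and iteration counts `K` with
`K 1 ≤ 1` and `K r ≤ K (r-1) + c`, the number of iterations for the last topleset
`ρ = e + 1` satisfies `K ρ ≤ c·√(2n) + 1`, i.e. `K ρ = O(√n)`. -/
theorem max_iterations_increasing_mesh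
    {V : Type*} [Fintype V] [DecidableEq V]
    (G : SimpleGraph V) (hG : G.Connected)
    (n : ℕ) (hn : n = Fintype.card V) (s : V)
    (e : ℕ) (he : e = Finset.univ.sup (fun v => G.dist s v))
    (hinc : ∀ r : ℕ, 1 ≤ r → r ≤ e →
      (Finset.univ.filter (fun v => G.dist s v = r - 1)).card <
      (Finset.univ.filter (fun v => G.dist s v = r)).card)
    (c : ℕ) (K : ℕ → ℕ)
    (h1 : K 1 ≤ 1)
    (hrec : ∀ r : ℕ, 2 ≤ r → K r ≤ K (r - 1) + c)
    (ρ : ℕ) (hρ : ρ = e + 1) :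
    (K ρ : ℝ) ≤ c * Real.sqrt (2 * n) + 1 := by
  subst hρ hn
  have hcard : (e + 1) * (e + 2) ≤ 2 * Fintype.card V :=
    mul_le_two_mul_card_of_sphere_lt G s e hinc
  have hsqrt : (e : ℝ) ≤ √(2 * Fintype.card V) := by
    apply Real.le_sqrt_of_sq_le
    exact_mod_cast (by nlinarith : e ^ 2 ≤ 2 * Fintype.card V)
  calc (K (e + 1) : ℝ) ≤ c * e + 1 := by
        exact_mod_cast iterations_le_mul_add_one c K h1 hrec e
    _ ≤ c * √(2 * Fintype.card V) + 1 := by gcongr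
end
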